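/- If A is a countable abelian group such that Ext¹_ℤ(A, ℤ) = 0 and Hom_ℤ(A, ℤ) = 0, then A is the trivial group. (This is the key algebraic step in the proof of Lemma 7: vanishing of Ext¹(A,ℤ) plus countability forces A to be free by the Stein–Serre theorem, and a free abelian group with Hom_ℤ(A,ℤ) = 0 is trivial.) -/

import Mathlib

open CategoryTheory

/-- A cocycle of a complex of morphisms out of a projective resolution is a coboundary
when `Ext¹` vanishes. -/
lemma CategoryTheory.ProjectiveResolution.exists_d_comp_eq {R C : Type*} [Ring R] [Category* C]
    [Abelian C] [Linear R C] [EnoughProjectives C] {X : C} (P : ProjectiveResolution X) (Y : C)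
    (hext : Subsingleton (((Ext R C 1).obj (Opposite.op X)).obj Y))
    (h : P.complex.X 1 ⟶ Y) (hh : P.complex.d 2 1 ≫ h = 0) :
    ∃ k : P.complex.X 0 ⟶ Y, P.complex.d 1 0 ≫ k = h := by
  have hz : Limits.IsZero ((P.complex.linearYonedaObj R Y).homology 1) :=
    (ModuleCat.isZero_of_subsingleton _).of_iso (P.isoExt 1 Y).symm
  rw [← HomologicalComplex.exactAt_iff_isZero_homology,
    HomologicalComplex.exactAt_iff' _ 0 1 2 (by simp) (by simp),
    ShortComplex.moduleCat_exact_iff] at hz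
  exact hz h hh

/-- If `Ext¹(X, S.X₁)` vanishes, then morphisms `X ⟶ S.X₃` lift along the epimorphism of the
short exact sequence `S`. -/
lemma CategoryTheory.ShortComplex.ShortExact.exists_lift_of_subsingleton_ext {R C : Type*} [Ring R]
    [Category* C] [Abelian C] [Linear R C] [EnoughProjectives C] {S : ShortComplex C}
    (hS : S.ShortExact) (X : C)
    (hext : Subsingleton (((Ext R C 1).obj (Opposite.op X)).obj S.X₁)) (φ : X ⟶ S.X₃) :
    ∃ f : X ⟶ S.X₂, f ≫ S.g = φ := by
  have := hS.epi_g
  have := hS.mono_f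
  let P := projectiveResolution X
  let ε : P.complex.X 0 ⟶ X := P.π.f 0
  have hε : P.complex.d 1 0 ≫ ε = 0 := P.complex_d_comp_π_f_zero
  let g : P.complex.X 0 ⟶ S.X₂ := Projective.factorThru (ε ≫ φ) S.g
  have hg : g ≫ S.g = ε ≫ φ := Projective.factorThru_comp _ _
  let h : P.complex.X 1 ⟶ S.X₁ := hS.exact.lift (P.complex.d 1 0 ≫ g)
    (by rw [Category.assoc, hg, reassoc_of% hε, Limits.zero_comp])
  have hh : h ≫ S.f = P.complex.d 1 0 ≫ g := hS.exact.lift_f _ _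
  obtain ⟨k, hk⟩ := P.exists_d_comp_eq S.X₁ hext h
    (by rw [← cancel_mono S.f, Category.assoc, hh]; simp)
  let f : X ⟶ S.X₂ := P.exact₀.desc (g - k ≫ S.f)
    (by simp [Preadditive.comp_sub, reassoc_of% hk, hh])
  have hf : ε ≫ f = g - k ≫ S.f := P.exact₀.g_desc _ _
  have : Epi ε := inferInstanceAs (Epi (P.π.f 0))
  refine ⟨f, ?_⟩
  rw [← cancel_epi ε, reassoc_of% hf]
  simp [Preadditive.sub_comp, hg]

/-- If `Ext¹(A, ℤ)` vanishes, then every homomorphism `A → ℚ/ℤ` lifts to `ℚ`. -/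
lemma CharacterModule.exists_lift_of_subsingleton_ext {A : Type} [AddCommGroup A]
    (hext : Subsingleton (((Ext ℤ (ModuleCat ℤ) 1).obj
      (Opposite.op (ModuleCat.of ℤ A))).obj (ModuleCat.of ℤ ℤ)))
    (φ : CharacterModule A) : ∃ f : A →+ ℚ, ∀ a, (f a : AddCircle (1 : ℚ)) = φ a := by
  let i : ℤ →ₗ[ℤ] ℚ := (Int.castAddHom ℚ).toIntLinearMap
  let q : ℚ →ₗ[ℤ] AddCircle (1 : ℚ) :=
    (QuotientAddGroup.mk' (AddSubgroup.zmultiples (1 : ℚ))).toIntLinearMap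
  have hiq : Function.Exact i q := fun x ↦ by
    change (x : AddCircle (1 : ℚ)) = 0 ↔ _
    rw [AddCircle.coe_eq_zero_iff]
    simp [i]
  let S : ShortComplex (ModuleCat.{0} ℤ) :=
    ShortComplex.mk (ModuleCat.ofHom i) (ModuleCat.ofHom q)
      (ModuleCat.hom_ext hiq.linearMap_comp_eq_zero)
  have hS : S.ShortExact := ModuleCat.shortComplex_shortExact S hiq
    Int.cast_injective (QuotientAddGroup.mk'_surjective _)
  obtain ⟨f, hf⟩ := hS.exists_lift_of_subsingleton_ext (ModuleCat.of ℤ A) hext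
    (ModuleCat.ofHom (AddMonoidHom.toIntLinearMap φ))
  exact ⟨f.hom.toAddMonoidHom, fun a ↦ congr($hf a)⟩

/-- If a subgroup `H` of `A` does not contain `b`, some homomorphism `A → ℚ` is integral on `H`
but not at `b`. -/
lemma exists_rat_hom_integral_on {A : Type*} [AddCommGroup A]
    (hlift : ∀ φ : CharacterModule A, ∃ f : A →+ ℚ, ∀ a, (f a : AddCircle (1 : ℚ)) = φ a)
    (H : AddSubgroup A) {b : A} (hb : b ∉ H) :
    ∃ f : A →+ ℚ, (∀ x ∈ H, ∃ n : ℤ, (n : ℚ) = f x) ∧ ¬ ∃ n : ℤ, (n : ℚ) = f b := by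
  obtain ⟨c, hc⟩ := CharacterModule.exists_character_apply_ne_zero_of_ne_zero
    (A := A ⧸ H) (a := (b : A ⧸ H)) (by rwa [Ne, QuotientAddGroup.eq_zero_iff])
  obtain ⟨f, hf⟩ := hlift (AddMonoidHom.comp (c : A ⧸ H →+ AddCircle (1 : ℚ))
    (QuotientAddGroup.mk' H))
  have key (x : A) : (∃ n : ℤ, (n : ℚ) = f x) ↔ c (x : A ⧸ H) = 0 := by
    have : (f x : AddCircle (1 : ℚ)) = c (x : A ⧸ H) := hf x
    rw [← this, AddCircle.coe_eq_zero_iff]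
    simp
  refine ⟨f, fun x hx ↦ (key x).2 ?_, fun h ↦ hc ((key b).1 h)⟩
  rw [(QuotientAddGroup.eq_zero_iff x).2 hx, map_zero]

lemma isAddTorsionFree_of_character_lift {A : Type*} [AddCommGroup A]
    (hlift : ∀ φ : CharacterModule A, ∃ f : A →+ ℚ, ∀ a, (f a : AddCircle (1 : ℚ)) = φ a) :
    IsAddTorsionFree A := by
  rw [isAddTorsionFree_iff_not_isOfFinAddOrder]
  intro a ha hfin
  obtain ⟨f, -, hf⟩ := exists_rat_hom_integral_on hlift ⊥ (b := a) (by simpa using ha)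
  have : f a = 0 := by
    obtain ⟨n, hn, hna⟩ := isOfFinAddOrder_iff_nsmul_eq_zero.1 hfin
    have := congr(f $hna)
    simpa [hn.ne'] using this
  exact hf ⟨0, by simp [this]⟩

lemma exists_nsmul_eq_of_character_lift {A : Type*} [AddCommGroup A] [Subsingleton (A →+ ℤ)]
    (hlift : ∀ φ : CharacterModule A, ∃ f : A →+ ℚ, ∀ a, (f a : AddCircle (1 : ℚ)) = φ a)
    {n : ℕ} (hn : n ≠ 0) (a : A) :
    ∃ b : A, n • b = a := by
  by_contra hna
  obtain ⟨f, hf, hfa⟩ := exists_rat_hom_integral_on hlift (nsmulAddMonoidHom (α := A) n).range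
    (b := a) (by simpa using hna)
  have hf' (x : A) : ∃ m : ℤ, (m : ℚ) = n • f x := by
    simpa using hf (n • x) ⟨x, rfl⟩
  choose g hg using hf'
  let g' : A →+ ℤ := AddMonoidHom.mk' g fun x y ↦ by
    apply Int.cast_injective (α := ℚ)
    simp [hg]
  have hga : g a = 0 := congr($(Subsingleton.elim g' 0) a)
  have := hg a
  exact hfa ⟨0, by simpa [hga, hn, eq_comm] using this⟩

/-- If `Hom(A, ℤ) = 0` and all homomorphisms `A → ℚ/ℤ` lift to `ℚ`, then `A` is trivial: for
`a ≠ 0`, no lift exists for a character vanishing on `ℤ[1/3] a` but not at `a / 2`. -/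
lemma subsingleton_of_character_lift {A : Type*} [AddCommGroup A] [Subsingleton (A →+ ℤ)]
    (hlift : ∀ φ : CharacterModule A, ∃ f : A →+ ℚ, ∀ a, (f a : AddCircle (1 : ℚ)) = φ a) :
    Subsingleton A := by
  have := isAddTorsionFree_of_character_lift hlift
  refine subsingleton_of_forall_eq 0 fun a ↦ by_contra fun ha ↦ ?_
  obtain ⟨b, hb⟩ := exists_nsmul_eq_of_character_lift hlift two_ne_zero a
  choose x hx using fun k : ℕ ↦
    exists_nsmul_eq_of_character_lift hlift (pow_ne_zero k three_ne_zero) a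
  let H : AddSubgroup A :=
    { carrier := {y | ∃ (k : ℕ) (m : ℤ), 3 ^ k • y = m • a}
      zero_mem' := ⟨0, 0, by simp⟩
      add_mem' := by
        rintro y z ⟨k, m, hy⟩ ⟨l, n, hz⟩
        refine ⟨k + l, 3 ^ l * m + 3 ^ k * n, ?_⟩
        have hy' := congr((3 ^ l : ℤ) • $hy)
        have hz' := congr((3 ^ k : ℤ) • $hz)
        rw [add_smul, mul_smul, mul_smul, ← hy', ← hz']
        module
      neg_mem' := by
        rintro y ⟨k, m, hy⟩
        exact ⟨k, -m, by rw [smul_neg, hy, neg_smul]⟩ }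
  have hbH : b ∉ H := by
    rintro ⟨k, m, hkm⟩
    have h : ((3 ^ k : ℤ) - 2 * m) • a = 0 := by
      have := congr((2 : ℤ) • $hkm)
      rw [sub_smul, mul_smul, ← this, ← hb]
      module
    have h3 : (3 ^ k : ℤ) - 2 * m = 0 := (smul_eq_zero.1 h).resolve_right ha
    have : Odd (3 ^ k : ℤ) := Odd.pow (by decide)
    exact (Int.not_even_iff_odd.2 this) ⟨m, by linarith⟩
  obtain ⟨f, hf, hfb⟩ := exists_rat_hom_integral_on hlift H hbH
  obtain ⟨n, hn⟩ := hf a ⟨0, 1, by simp⟩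
  have hdvd (k : ℕ) : (3 : ℤ) ^ k ∣ n := by
    obtain ⟨m, hm⟩ := hf (x k) ⟨k, 1, by simp [hx]⟩
    refine ⟨m, Int.cast_injective (α := ℚ) ?_⟩
    rw [hn, ← hx k, map_nsmul, ← hm]
    simp
  have hn0 : n = 0 := by
    by_contra h0
    have h1 := Int.natAbs_dvd_natAbs.2 (hdvd n.natAbs)
    have h2 := Nat.le_of_dvd (Int.natAbs_pos.2 h0) h1
    rw [Int.natAbs_pow] at h2
    exact absurd h2 (Nat.lt_pow_self (by norm_num)).not_ge
  refine hfb ⟨0, ?_⟩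
  have := congr(f $hb)
  simpa [← hn, hn0, eq_comm] using this

/-- If `A` is a countable abelian group with `Ext¹_ℤ(A, ℤ) = 0` and `Hom_ℤ(A, ℤ) = 0`,
then `A` is trivial. -/
theorem trivial_of_ext_and_hom_eq_zero (A : Type) [AddCommGroup A] [Countable A]
    (hext : Subsingleton (((Ext ℤ (ModuleCat ℤ) 1).obj
      (Opposite.op (ModuleCat.of ℤ A))).obj (ModuleCat.of ℤ ℤ)))
    (hhom : Subsingleton (A →+ ℤ)) :
    Subsingleton A :=
  subsingleton_of_character_lift (CharacterModule.exists_lift_of_subsingleton_ext hext)
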